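/- arXiv:2310.08285 — 2 statements merged into one kernel-verified Lean document; each statement's English description precedes it below -/
import Mathlib

section
/- Let W be a nonempty finite set (of OD pairs) and M a finite set (of operators). Let q : W → ℝ with 0 ≤ q w, α : W → ℝ, β : W → ℝ, λ : W → ℝ with 0 ≤ λ w, a real number σ with 0 ≤ σ, and c, r, B : M → ℝ with 0 ≤ c m, such that for every m ∈ M, either 0 < c m or B m ≤ r m. Define the feasible set S of pairs (p_d, p_s) with p_d : W → ℝ and p_s : ℝ by: 0 ≤ p_s, p_d w ≤ α w for all w, p_d w ≤ β w + p_s * λ w for all w, and B m ≤ p_s * c m + r m for all m. Then S is nonempty, and there exists (p_d*, p_s*) ∈ S such that for all (p_d, p_s) ∈ S, ∑_{w∈W} q w * p_d w − p_s * σ ≤ ∑_{w∈W} q w * p_d* w − p_s* * σ. -/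
/-- For large `p`, every constraint `b i ≤ p * a i` with positive coefficient holds. -/
lemma eventually_forall_le_mul_of_pos {ι : Type*} [Finite ι] (a b : ι → ℝ) :
    ∀ᶠ p : ℝ in Filter.atTop, ∀ i, 0 < a i → b i ≤ p * a i := by
  rw [Filter.eventually_all]
  intro i
  filter_upwards [Filter.eventually_ge_atTop (b i / a i)] with p hp hi
  exact (div_le_iff₀ hi).mp hp

/-- Existence of a finite optimal pricing scheme for the MaaS pricing linear
program: the feasible set of pricing schemes `(p_d, p_s)` is nonempty and
contains a maximizer of the platform profit `∑ w, q w * p_d w − p_s * σ`. -/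
theorem exists_optimal_pricing {W M : Type*} [Fintype W] [Fintype M] [Nonempty W]
    (q α β lam : W → ℝ) (hq : ∀ w, 0 ≤ q w) (hlam : ∀ w, 0 ≤ lam w)
    (σ : ℝ) (hσ : 0 ≤ σ)
    (c r B : M → ℝ) (hc : ∀ m, 0 ≤ c m)
    (hfeas : ∀ m, 0 < c m ∨ B m ≤ r m) :
    let S : Set ((W → ℝ) × ℝ) :=
      {pr | 0 ≤ pr.2 ∧ (∀ w, pr.1 w ≤ α w) ∧
        (∀ w, pr.1 w ≤ β w + pr.2 * lam w) ∧ (∀ m, B m ≤ pr.2 * c m + r m)}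
    S.Nonempty ∧
      ∃ pstar ∈ S, ∀ pr ∈ S,
        ∑ w, q w * pr.1 w - pr.2 * σ ≤ ∑ w, q w * pstar.1 w - pstar.2 * σ := by
  intro S
  set f : ℝ → ℝ := fun p => ∑ w, q w * min (α w) (β w + p * lam w) - p * σ
  obtain ⟨T, hT0, hTlam, hTc⟩ := ((Filter.eventually_ge_atTop (0 : ℝ)).and
    ((eventually_forall_le_mul_of_pos lam fun w => α w - β w).and
      (eventually_forall_le_mul_of_pos c fun m => B m - r m))).exists
  have hTB : ∀ m, B m ≤ T * c m + r m := by
    intro m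
    rcases hfeas m with h | h
    · linarith [hTc m h]
    · linarith [mul_nonneg hT0 (hc m)]
  have hmem : ∀ p, 0 ≤ p → (∀ m, B m ≤ p * c m + r m) →
      ((fun w => min (α w) (β w + p * lam w)), p) ∈ S := fun p hp hB =>
    ⟨hp, fun w => min_le_left _ _, fun w => min_le_right _ _, hB⟩
  refine ⟨⟨_, hmem T hT0 hTB⟩, ?_⟩
  have hclosed : IsClosed {p : ℝ | ∀ m, B m ≤ p * c m + r m} := by
    rw [Set.ofPred_forall]
    exact isClosed_iInter fun m => isClosed_le (by fun_prop) (by fun_prop)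
  obtain ⟨s, ⟨⟨hs0, -⟩, hsB⟩, hmax⟩ := (isCompact_Icc.inter_right hclosed).exists_isMaxOn
    ⟨T, ⟨hT0, le_rfl⟩, hTB⟩ (show Continuous f by fun_prop).continuousOn
  refine ⟨_, hmem s hs0 hsB, ?_⟩
  rintro ⟨d, p⟩ ⟨hp0, hdα, hdβ, hpB⟩
  have hdf : ∑ w, q w * d w - p * σ ≤ f p :=
    sub_le_sub_right (Finset.sum_le_sum fun w _ =>
      mul_le_mul_of_nonneg_left (le_min (hdα w) (hdβ w)) (hq w)) _
  refine hdf.trans ?_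
  rcases le_total p T with hpT | hTp
  · exact hmax ⟨⟨hp0, hpT⟩, hpB⟩
  · refine le_trans ?_ (hmax ⟨⟨hT0, le_rfl⟩, hTB⟩)
    refine sub_le_sub (Finset.sum_le_sum fun w _ => mul_le_mul_of_nonneg_left ?_ (hq w))
      (mul_le_mul_of_nonneg_right hTp hσ)
    rcases (hlam w).eq_or_lt with h | h
    · simp [← h]
    · exact le_min (min_le_left _ _) ((min_le_left _ _).trans (by linarith [hTlam w h]))
end

section
/- Let q, c, λ, A, B, L be real numbers with 0 < q, 0 < c, 0 < λ, A > B + λ * L, and q * λ > c. Consider the feasible set S = {(x, y) ∈ ℝ × ℝ | x ≤ A, x ≤ B + λ * y, L ≤ y}. Then (A, (A − B)/λ) ∈ S, and for every (x, y) ∈ S, q * x − c * y ≤ q * A − c * (A − B)/λ, with equality if and only if (x, y) = (A, (A − B)/λ). In particular, (A, (A − B)/λ) is the unique maximizer of (x, y) ↦ q * x − c * y on S. -/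
/-- Per-OD-pair pricing subproblem, Case 3 with `qλ > c`: the extreme point
`I₂ = (A, (A − B)/λ)` is the unique maximizer of `(x, y) ↦ q x − c y` over the
feasible region. -/
theorem pricing_subproblem_case3_I2 (q c lam A B L : ℝ)
    (hq : 0 < q) (hc : 0 < c) (hlam : 0 < lam)
    (hAB : A > B + lam * L) (hslope : q * lam > c) :
    let S : Set (ℝ × ℝ) := {p | p.1 ≤ A ∧ p.1 ≤ B + lam * p.2 ∧ L ≤ p.2}
    (A, (A - B) / lam) ∈ S ∧
      ∀ p ∈ S, q * p.1 - c * p.2 ≤ q * A - c * ((A - B) / lam) ∧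
        (q * p.1 - c * p.2 = q * A - c * ((A - B) / lam) ↔ p = (A, (A - B) / lam)) := by
  intro S
  have hcancel : lam * ((A - B) / lam) = A - B := mul_div_cancel₀ _ hlam.ne'
  refine ⟨⟨le_rfl, ?_, ?_⟩, ?_⟩
  · change A ≤ B + lam * ((A - B) / lam)
    linarith
  · change L ≤ (A - B) / lam
    rw [le_div_iff₀ hlam]
    linarith
  rintro ⟨x, y⟩ ⟨hxA, hxB, -⟩
  dsimp only at hxA hxB ⊢
  have hgap : lam * ((q * A - c * ((A - B) / lam)) - (q * x - c * y)) =
      (q * lam - c) * (A - x) + c * (B + lam * y - x) := by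
    linear_combination -c * hcancel
  have hu : 0 ≤ (q * lam - c) * (A - x) :=
    mul_nonneg (sub_nonneg.2 hslope.le) (sub_nonneg.2 hxA)
  have hv : 0 ≤ c * (B + lam * y - x) := mul_nonneg hc.le (sub_nonneg.2 hxB)
  refine ⟨sub_nonneg.1 (nonneg_of_mul_nonneg_right (hgap ▸ add_nonneg hu hv) hlam),
    fun heq => ?_, fun h => ?_⟩
  · rw [heq, sub_self, mul_zero] at hgap
    have hx : A - x = 0 :=
      (mul_eq_zero.1 (by linarith : (q * lam - c) * (A - x) = 0)).resolve_left
        (sub_pos.2 hslope).ne'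
    have hy : B + lam * y - x = 0 :=
      (mul_eq_zero.1 (by linarith : c * (B + lam * y - x) = 0)).resolve_left hc.ne'
    refine Prod.ext (sub_eq_zero.1 hx).symm ?_
    change y = (A - B) / lam
    rw [eq_div_iff hlam.ne']
    linarith
  · obtain ⟨rfl, rfl⟩ := Prod.mk.inj h
    rfl
end
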